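/- arXiv:2009.06267 — 2 statements merged into one kernel-verified Lean document; each statement's English description precedes it below -/
import Mathlib

section
/- Let (φ_m)_{m≥1} be any sequence of real numbers with 0 < φ_{m+1} < φ_m for all m ≥ 1. Then the series S₂(z) := ∑_{m=1}^∞ (−1)^m (φ_m/m²) sin(mz) satisfies S₂(z) < 0 for every z ∈ (0, π). -/
open Real

theorem two_mul_sin_half_mul_sum_cos (n : ℕ) (y : ℝ) :
    2 * sin (y / 2) * ∑ m ∈ Finset.range n, cos (((m : ℝ) + 1) * y) =
      sin ((n : ℝ) * y + y / 2) - sin (y / 2) := by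
  induction n with
  | zero => simp
  | succ n ih =>
    rw [Finset.sum_range_succ, mul_add, ih]
    have h1 : ((n + 1 : ℕ) : ℝ) * y + y / 2 = ((n : ℝ) + 1) * y + y / 2 := by push_cast; ring
    have h2 : (n : ℝ) * y + y / 2 = ((n : ℝ) + 1) * y - y / 2 := by ring
    rw [h1, h2, sin_add, sin_sub]
    ring

theorem hasDerivAt_sum_sin_div (n : ℕ) (y : ℝ) :
    HasDerivAt (fun w : ℝ => ∑ m ∈ Finset.range n, sin (((m : ℝ) + 1) * w) / ((m : ℝ) + 1))
      (∑ m ∈ Finset.range n, cos (((m : ℝ) + 1) * y)) y := by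
  refine HasDerivAt.fun_sum fun m _ => ?_
  have hm : (m : ℝ) + 1 ≠ 0 := by positivity
  have h := (((hasDerivAt_id y).const_mul ((m : ℝ) + 1)).sin).div_const ((m : ℝ) + 1)
  refine h.congr_deriv ?_
  simp only [id]
  field_simp

theorem sin_natCast_mul_nonneg_of_sum_cos_eq_zero {n : ℕ} {y : ℝ} (hy : y ∈ Set.Ioo 0 π)
    (h : ∑ m ∈ Finset.range n, cos (((m : ℝ) + 1) * y) = 0) : 0 ≤ sin ((n : ℝ) * y) := by
  have hsin : sin ((n : ℝ) * y + y / 2) = sin (y / 2) := by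
    have := two_mul_sin_half_mul_sum_cos n y
    rw [h] at this
    linarith
  have hs : 0 < sin (y / 2) :=
    sin_pos_of_pos_of_lt_pi (by linarith [hy.1]) (by linarith [hy.2, pi_pos])
  have hc : 0 < cos (y / 2) :=
    cos_pos_of_mem_Ioo ⟨by linarith [hy.1, pi_pos], by linarith [hy.2]⟩
  have hcos : cos ((n : ℝ) * y + y / 2) ≤ cos (y / 2) := by
    refine (abs_le_of_sq_le_sq' ?_ hc.le).2
    rw [cos_sq', cos_sq', hsin]
  have hsub : (n : ℝ) * y = ((n : ℝ) * y + y / 2) - y / 2 := by ring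
  rw [hsub, sin_sub, hsin]
  nlinarith

/-- The **Fejér–Jackson inequality**. -/
theorem sum_sin_div_pos (n : ℕ) {w : ℝ} (hw : w ∈ Set.Ioo 0 π) :
    0 < ∑ m ∈ Finset.range (n + 1), sin (((m : ℝ) + 1) * w) / ((m : ℝ) + 1) := by
  induction n generalizing w with
  | zero => simpa using sin_pos_of_mem_Ioo hw
  | succ n ih =>
    by_contra! hneg
    set F : ℝ → ℝ := fun w => ∑ m ∈ Finset.range (n + 1 + 1),
      sin (((m : ℝ) + 1) * w) / ((m : ℝ) + 1) with hF
    have hcont : Continuous F := by fun_prop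
    obtain ⟨x, hx, hmin⟩ := isCompact_Icc.exists_isMinOn
      (Set.nonempty_Icc.2 pi_pos.le) hcont.continuousOn
    have hF0 : F 0 = 0 := by simp [hF]
    have hFpi : F π = 0 := by
      refine Finset.sum_eq_zero fun m _ => ?_
      have := sin_nat_mul_pi (m + 1)
      push_cast at this
      rw [this, zero_div]
    obtain ⟨y, hy, hFy, hymin⟩ : ∃ y ∈ Set.Ioo 0 π, F y ≤ 0 ∧ IsMinOn F (Set.Icc 0 π) y := by
      by_cases hxI : x ∈ Set.Ioo 0 π
      · exact ⟨x, hxI, (hmin (Set.Ioo_subset_Icc_self hw)).trans hneg, hmin⟩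
      · have hFx : F x = 0 := by
          rcases hx.1.eq_or_lt with h | h
          · rw [← h, hF0]
          · rcases hx.2.eq_or_lt with h' | h'
            · rw [h', hFpi]
            · exact absurd ⟨h, h'⟩ hxI
        refine ⟨w, hw, hneg, fun t ht => ?_⟩
        have : F x ≤ F t := hmin ht
        exact hneg.trans (hFx ▸ this)
    have hderiv := (hymin.isLocalMin (Icc_mem_nhds hy.1 hy.2)).hasDerivAt_eq_zero
      (hasDerivAt_sum_sin_div (n + 1 + 1) y)
    have hlast := sin_natCast_mul_nonneg_of_sum_cos_eq_zero hy hderiv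
    have hprev := ih hy
    have hsplit : F y = (∑ m ∈ Finset.range (n + 1), sin (((m : ℝ) + 1) * y) / ((m : ℝ) + 1)) +
        sin (((n + 1 + 1 : ℕ) : ℝ) * y) / ((n + 1 + 1 : ℕ) : ℝ) := by
      simp only [hF]
      rw [Finset.sum_range_succ _ (n + 1)]
      push_cast
      rfl
    have : 0 ≤ sin (((n + 1 + 1 : ℕ) : ℝ) * y) / ((n + 1 + 1 : ℕ) : ℝ) := by positivity
    linarith

theorem abel_lower_bound {ψ a : ℕ → ℝ} (hψ : Antitone ψ)
    (ha : ∀ n, 0 ≤ ∑ m ∈ Finset.range (n + 1), a m) (n : ℕ) :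
    (ψ 0 - ψ 1) * a 0 + ψ (n + 1) * ∑ m ∈ Finset.range (n + 2), a m ≤
      ∑ m ∈ Finset.range (n + 2), ψ m * a m := by
  induction n with
  | zero => simp only [Finset.sum_range_succ, Finset.sum_range_zero]; linarith
  | succ n ih =>
    rw [Finset.sum_range_succ _ (n + 2), Finset.sum_range_succ _ (n + 2)]
    have := mul_le_mul_of_nonneg_right (hψ (Nat.le_succ (n + 1))) (ha (n + 1))
    simp only [Nat.succ_eq_add_one, add_assoc, Nat.reduceAdd] at *
    linarith

theorem stmt1 (φ : ℕ → ℝ) (hφ : ∀ m : ℕ, 1 ≤ m → 0 < φ (m + 1) ∧ φ (m + 1) < φ m)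
    (z : ℝ) (hz : z ∈ Set.Ioo 0 π) :
    (∑' m : ℕ, (-1 : ℝ) ^ (m + 1) * (φ (m + 1) / ((m : ℝ) + 1) ^ 2) *
      Real.sin (((m : ℝ) + 1) * z)) < 0 := by
  have hpos (m : ℕ) : 0 < φ (m + 1) := by
    have := hφ (m + 1) (by lia)
    exact this.1.trans this.2
  have hanti : Antitone fun m => φ (m + 1) :=
    antitone_nat_of_succ_le fun m => (hφ (m + 1) (by lia)).2.le
  set ψ : ℕ → ℝ := fun m => φ (m + 1) / ((m : ℝ) + 1) with hψ_def
  set a : ℕ → ℝ := fun m => sin (((m : ℝ) + 1) * (π - z)) / ((m : ℝ) + 1) with ha_def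
  have hw : π - z ∈ Set.Ioo 0 π := ⟨by linarith [hz.2], by linarith [hz.1]⟩
  have hψ : Antitone ψ := fun i j hij =>
    div_le_div₀ (hpos i).le (hanti hij) (by positivity) (by gcongr)
  have hψ01 : ψ 1 < ψ 0 := by
    have h1 := hpos 1
    have h2 := (hφ 1 le_rfl).2
    norm_num [hψ_def] at h1 h2 ⊢
    linarith
  have hterm (m : ℕ) : (-1 : ℝ) ^ (m + 1) * (φ (m + 1) / ((m : ℝ) + 1) ^ 2) *
      sin (((m : ℝ) + 1) * z) = -(ψ m * a m) := by
    have h := sin_nat_mul_pi_sub (((m : ℝ) + 1) * z) (m + 1)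
    have harg : ((m : ℝ) + 1) * (π - z) = ((m + 1 : ℕ) : ℝ) * π - ((m : ℝ) + 1) * z := by
      push_cast; ring
    simp only [hψ_def, ha_def]
    rw [harg, h]
    field_simp
  have hsum : Summable fun m => ψ m * a m := by
    have hs : Summable fun m : ℕ => φ 1 * (1 / ((m + 1 : ℕ) : ℝ) ^ 2) :=
      ((summable_nat_add_iff 1).2 (summable_one_div_nat_pow.2 one_lt_two)).mul_left _
    refine hs.of_norm_bounded fun m => ?_
    have h1 : φ (m + 1) ≤ φ 1 := hanti (Nat.zero_le m)
    have h2 := abs_sin_le_one (((m : ℝ) + 1) * (π - z))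
    have h3 : ψ m * a m =
        φ (m + 1) * sin (((m : ℝ) + 1) * (π - z)) * (1 / ((m + 1 : ℕ) : ℝ) ^ 2) := by
      simp only [hψ_def, ha_def]
      push_cast
      field_simp
    rw [h3, norm_eq_abs, abs_mul, abs_mul, abs_of_pos (hpos m),
      abs_of_nonneg (by positivity : (0 : ℝ) ≤ 1 / ((m + 1 : ℕ) : ℝ) ^ 2)]
    gcongr
    nlinarith [hpos m]
  have ha (n : ℕ) : 0 < ∑ m ∈ Finset.range (n + 1), a m := sum_sin_div_pos n hw
  have hlower : (ψ 0 - ψ 1) * a 0 ≤ ∑' m, ψ m * a m := by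
    refine ge_of_tendsto' ((Filter.tendsto_add_atTop_iff_nat 2).2 hsum.hasSum.tendsto_sum_nat)
      fun n => ?_
    have hψn : 0 < ψ (n + 1) := div_pos (hpos _) (by positivity)
    linarith [abel_lower_bound hψ (fun n => (ha n).le) n, mul_pos hψn (ha (n + 1))]
  have ha0 : 0 < a 0 := by simpa using ha 0
  rw [tsum_congr hterm, tsum_neg]
  linarith [mul_pos (sub_pos.2 hψ01) ha0]
end

section
/- Let (φ_m)_{m≥1} be any sequence of real numbers with 0 < φ_{m+1} < φ_m for all m ≥ 1, and define K(x,ρ) := ∑_{m=1}^∞ (φ_m/m³) sin(mρ) sin(mx) for x, ρ ∈ [0, π]. Then for all x, ρ ∈ [0, π/2] one has K(x,ρ) ≥ max{ K(π−x, ρ), K(x, π−ρ) }, and the inequality is strict whenever x ∈ (0, π/2) and ρ ∈ (0, π/2). -/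
open Real

/-- Abel summation: if the partial sums of `a` are nonnegative and `w` is antitone, then
weighted partial sums dominate the unweighted ones multiplied by the last weight. -/
lemma antitone_mul_sum_le_sum_mul (w a : ℕ → ℝ) (hw : Antitone w)
    (ha : ∀ n, 0 ≤ ∑ i ∈ Finset.range n, a i) (n : ℕ) :
    w n * ∑ i ∈ Finset.range n, a i ≤ ∑ i ∈ Finset.range n, w i * a i := by
  induction n with
  | zero => simp
  | succ n ih =>
    calc w (n + 1) * ∑ i ∈ Finset.range (n + 1), a i
        ≤ w n * ∑ i ∈ Finset.range (n + 1), a i :=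
          mul_le_mul_of_nonneg_right (hw n.le_succ) (ha _)
      _ = w n * ∑ i ∈ Finset.range n, a i + w n * a n := by
          rw [Finset.sum_range_succ, mul_add]
      _ ≤ _ := by rw [Finset.sum_range_succ]; gcongr

lemma sum_mul_nonneg_of_antitone (w a : ℕ → ℝ) (hw : Antitone w) (hw0 : ∀ n, 0 ≤ w n)
    (ha : ∀ n, 0 ≤ ∑ i ∈ Finset.range n, a i) (n : ℕ) :
    0 ≤ ∑ i ∈ Finset.range n, w i * a i :=
  (mul_nonneg (hw0 n) (ha n)).trans (antitone_mul_sum_le_sum_mul w a hw ha n)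

/-- Abel summation keeping the first term of the summation by parts. -/
lemma sub_mul_le_sum_mul_of_antitone (w a : ℕ → ℝ) (hw : Antitone w) (hw0 : ∀ n, 0 ≤ w n)
    (ha : ∀ n, 0 ≤ ∑ i ∈ Finset.range n, a i) (n : ℕ) :
    (w 0 - w 1) * a 0 ≤ ∑ i ∈ Finset.range (n + 1), w i * a i := by
  have hanti : Antitone fun i => w (max i 1) :=
    fun i j hij => hw (max_le_max_right 1 hij)
  have h := sum_mul_nonneg_of_antitone (fun i => w (max i 1)) a hanti (fun _ => hw0 _) ha (n + 1)
  rw [Finset.sum_range_succ'] at h ⊢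
  simp only [Nat.le_add_left, sup_of_le_left, zero_le, sup_of_le_right] at h
  linarith

lemma sum_cos_mul_two_sin_half (t : ℝ) (N : ℕ) :
    (∑ i ∈ Finset.range N, cos (((i : ℝ) + 1) * t)) * (2 * sin (t / 2)) =
      sin (N * t + t / 2) - sin (t / 2) := by
  induction N with
  | zero => simp
  | succ N ih =>
    rw [Finset.sum_range_succ, add_mul, ih]
    have h1 : (N : ℝ) * t + t / 2 = ((N : ℝ) + 1) * t - t / 2 := by ring
    push_cast
    rw [h1, sin_sub, sin_add]
    ring

/-- The Fejér–Jackson inequality (weak form). -/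
lemma sum_sin_div_nonneg (N : ℕ) :
    ∀ t ∈ Set.Icc (0 : ℝ) π, 0 ≤ ∑ i ∈ Finset.range N, sin (((i : ℝ) + 1) * t) / ((i : ℝ) + 1) := by
  induction N with
  | zero => simp
  | succ N ih =>
    set S : ℝ → ℝ :=
      fun t => ∑ i ∈ Finset.range (N + 1), sin (((i : ℝ) + 1) * t) / ((i : ℝ) + 1) with hS
    have hderiv (t : ℝ) :
        HasDerivAt S (∑ i ∈ Finset.range (N + 1), cos (((i : ℝ) + 1) * t)) t := by
      refine HasDerivAt.fun_sum fun i _ => ?_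
      have h := (((hasDerivAt_id t).const_mul ((i : ℝ) + 1)).sin).div_const ((i : ℝ) + 1)
      have hi : (i : ℝ) + 1 ≠ 0 := by positivity
      refine h.congr_deriv ?_
      simp only [id]
      field_simp
    have hcont : Continuous S :=
      continuous_iff_continuousAt.2 fun t => (hderiv t).continuousAt
    obtain ⟨s, hs, hmin⟩ := isCompact_Icc.exists_isMinOn
      (Set.nonempty_Icc.2 pi_pos.le) hcont.continuousOn
    suffices h : 0 ≤ S s from fun t ht => h.trans (hmin ht)
    rcases hs.1.eq_or_lt with h0 | h0
    · simp [hS, ← h0]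
    rcases hs.2.eq_or_lt with hp | hp
    · refine (Finset.sum_eq_zero fun i _ => ?_).ge
      have h := sin_nat_mul_pi (i + 1)
      push_cast at h
      rw [hp, h, zero_div]
    have hzero := (hmin.isLocalMin (Icc_mem_nhds h0 hp)).hasDerivAt_eq_zero (hderiv s)
    have hid := sum_cos_mul_two_sin_half s (N + 1)
    rw [hzero, zero_mul] at hid
    have hsin : sin (((N + 1 : ℕ) : ℝ) * s + s / 2) = sin (s / 2) := by linarith
    have hcos : cos (((N + 1 : ℕ) : ℝ) * s + s / 2) ≤ cos (s / 2) := by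
      refine le_of_abs_le (sq_le_sq.1 ?_) |>.trans (abs_of_nonneg ?_).le
      · rw [cos_sq', cos_sq', hsin]
      · exact cos_nonneg_of_mem_Icc ⟨by linarith [pi_pos], by linarith⟩
    have hlast : 0 ≤ sin (((N : ℝ) + 1) * s) := by
      have h : sin (((N : ℝ) + 1) * s) =
          sin (s / 2) * (cos (s / 2) - cos (((N + 1 : ℕ) : ℝ) * s + s / 2)) := by
        have h1 : ((N : ℝ) + 1) * s = (((N + 1 : ℕ) : ℝ) * s + s / 2) - s / 2 := by
          push_cast; ring
        rw [h1, sin_sub, hsin]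
        ring
      rw [h]
      exact mul_nonneg (sin_nonneg_of_nonneg_of_le_pi (by linarith) (by linarith))
        (sub_nonneg.2 hcos)
    simp only [hS, Finset.sum_range_succ]
    exact add_nonneg (ih s hs) (by positivity)

lemma sum_sin_div_sq_nonneg (N : ℕ) {t : ℝ} (ht : t ∈ Set.Icc (0 : ℝ) π) :
    0 ≤ ∑ i ∈ Finset.range N, sin (((i : ℝ) + 1) * t) / ((i : ℝ) + 1) ^ 2 := by
  have hanti : Antitone fun i : ℕ => 1 / ((i : ℝ) + 1) := fun i j hij =>
    one_div_le_one_div_of_le (by positivity) (by gcongr)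
  refine (sum_mul_nonneg_of_antitone _ _ hanti (fun i => by positivity)
    (fun n => sum_sin_div_nonneg n t ht) N).trans_eq (Finset.sum_congr rfl fun i _ => ?_)
  field_simp

lemma antitoneOn_sum_cos_div_cube (N : ℕ) :
    AntitoneOn (fun t : ℝ => ∑ i ∈ Finset.range N, cos (((i : ℝ) + 1) * t) / ((i : ℝ) + 1) ^ 3)
      (Set.Icc 0 π) := by
  have hderiv (t : ℝ) :
      HasDerivAt (fun t : ℝ => ∑ i ∈ Finset.range N, cos (((i : ℝ) + 1) * t) / ((i : ℝ) + 1) ^ 3)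
        (∑ i ∈ Finset.range N, -(sin (((i : ℝ) + 1) * t) / ((i : ℝ) + 1) ^ 2)) t := by
    refine HasDerivAt.fun_sum fun i _ => ?_
    have h := (((hasDerivAt_id t).const_mul ((i : ℝ) + 1)).cos).div_const (((i : ℝ) + 1) ^ 3)
    have hi : (i : ℝ) + 1 ≠ 0 := by positivity
    refine h.congr_deriv ?_
    simp only [id]
    field_simp
  refine antitoneOn_of_deriv_nonpos (convex_Icc 0 π)
    (fun t _ => (hderiv t).continuousAt.continuousWithinAt)
    (fun t _ => (hderiv t).differentiableAt.differentiableWithinAt) fun t ht => ?_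
  rw [(hderiv t).deriv, Finset.sum_neg_distrib]
  exact neg_nonpos.2 (sum_sin_div_sq_nonneg N (interior_subset ht))

lemma sum_sin_mul_sin_div_cube_nonneg (N : ℕ) {x y : ℝ}
    (hx : x ∈ Set.Icc (0 : ℝ) π) (hy : y ∈ Set.Icc (0 : ℝ) π) :
    0 ≤ ∑ i ∈ Finset.range N,
      sin (((i : ℝ) + 1) * x) * sin (((i : ℝ) + 1) * y) / ((i : ℝ) + 1) ^ 3 := by
  set H : ℝ → ℝ :=
    fun t => ∑ i ∈ Finset.range N, cos (((i : ℝ) + 1) * t) / ((i : ℝ) + 1) ^ 3 with hH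
  have hanti : AntitoneOn H (Set.Icc 0 π) := antitoneOn_sum_cos_div_cube N
  have habs : H (x - y) = H |x - y| := by
    rcases abs_choice (x - y) with h | h <;> rw [h]
    simp only [hH, mul_neg, cos_neg]
  have hper : H (x + y) = H (2 * π - (x + y)) := by
    refine Finset.sum_congr rfl fun i _ => ?_
    have h := cos_nat_mul_two_pi_sub (((i : ℝ) + 1) * (x + y)) (i + 1)
    push_cast at h
    rw [← h]
    ring_nf
  have hmono : H (x + y) ≤ H (x - y) := by
    obtain ⟨hx0, hxp⟩ := hx
    obtain ⟨hy0, hyp⟩ := hy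
    have hle : |x - y| ≤ π := abs_le.2 ⟨by linarith, by linarith⟩
    rw [habs]
    rcases le_total (x + y) π with h | h
    · exact hanti ⟨abs_nonneg _, hle⟩ ⟨by linarith, h⟩
        (abs_le.2 ⟨by linarith, by linarith⟩)
    · rw [hper]
      exact hanti ⟨abs_nonneg _, hle⟩ ⟨by linarith, by linarith⟩
        (abs_le.2 ⟨by linarith, by linarith⟩)
  have hprod : ∑ i ∈ Finset.range N,
      sin (((i : ℝ) + 1) * x) * sin (((i : ℝ) + 1) * y) / ((i : ℝ) + 1) ^ 3 =
      (H (x - y) - H (x + y)) / 2 := by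
    simp only [hH]
    rw [← Finset.sum_sub_distrib, Finset.sum_div]
    refine Finset.sum_congr rfl fun i _ => ?_
    rw [mul_sub, mul_add, cos_sub, cos_add]
    ring
  rw [hprod]
  linarith

lemma sin_nat_succ_mul_pi_sub (m : ℕ) (x : ℝ) :
    sin (((m : ℝ) + 1) * (π - x)) = (-1) ^ m * sin (((m : ℝ) + 1) * x) := by
  have h := sin_nat_mul_pi_sub (((m : ℝ) + 1) * x) (m + 1)
  push_cast at h
  rw [mul_sub, h]
  ring

theorem stmt14 (φ : ℕ → ℝ) (hφ : ∀ m : ℕ, 1 ≤ m → 0 < φ (m + 1) ∧ φ (m + 1) < φ m)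
    (K : ℝ → ℝ → ℝ)
    (hK : ∀ x ρ : ℝ, K x ρ =
      ∑' m : ℕ, φ (m + 1) / ((m : ℝ) + 1) ^ 3 *
        Real.sin (((m : ℝ) + 1) * ρ) * Real.sin (((m : ℝ) + 1) * x)) :
    ∀ x ∈ Set.Icc (0 : ℝ) (π / 2), ∀ ρ ∈ Set.Icc (0 : ℝ) (π / 2),
      max (K (π - x) ρ) (K x (π - ρ)) ≤ K x ρ ∧
      (x ∈ Set.Ioo (0 : ℝ) (π / 2) → ρ ∈ Set.Ioo (0 : ℝ) (π / 2) →
        max (K (π - x) ρ) (K x (π - ρ)) < K x ρ) := by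
  intro x hx ρ hρ
  have hanti : StrictAnti fun m => φ (m + 1) :=
    strictAnti_nat_of_succ_lt fun m => (hφ (m + 1) (by omega)).2
  have hpos (m : ℕ) : 0 < φ (m + 1) :=
    (hφ (m + 1) (by omega)).1.trans (hφ (m + 1) (by omega)).2
  set f : ℕ → ℝ := fun m => φ (m + 1) / ((m : ℝ) + 1) ^ 3 *
    sin (((m : ℝ) + 1) * ρ) * sin (((m : ℝ) + 1) * x) with hf
  have hK1 : K (π - x) ρ = ∑' m, (-1) ^ m * f m := by
    rw [hK]
    refine tsum_congr fun m => ?_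
    rw [sin_nat_succ_mul_pi_sub]
    ring
  have hK2 : K x (π - ρ) = ∑' m, (-1) ^ m * f m := by
    rw [hK]
    refine tsum_congr fun m => ?_
    rw [sin_nat_succ_mul_pi_sub]
    ring
  have hbound : Summable fun m : ℕ => φ 1 * (1 / ((m : ℝ) + 1) ^ 3) := by
    have h := (summable_nat_add_iff 1).2 (Real.summable_one_div_nat_pow.2 (by norm_num : 1 < 3))
    push_cast at h
    exact h.mul_left _
  have hle (m : ℕ) : |f m| ≤ φ 1 * (1 / ((m : ℝ) + 1) ^ 3) := by
    have hφm : φ (m + 1) ≤ φ 1 := hanti.antitone m.zero_le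
    simp only [hf, abs_mul]
    rw [abs_of_pos (div_pos (hpos m) (by positivity)), mul_assoc]
    calc _ ≤ φ (m + 1) / ((m : ℝ) + 1) ^ 3 * 1 := by
          refine mul_le_mul_of_nonneg_left ?_ (div_pos (hpos m) (by positivity)).le
          exact mul_le_one₀ (abs_sin_le_one _) (abs_nonneg _) (abs_sin_le_one _)
      _ ≤ _ := by
          rw [mul_one, mul_one_div]
          gcongr
  have hsum : Summable f := Summable.of_norm_bounded hbound hle
  have hsum' : Summable fun m => (-1) ^ m * f m :=
    Summable.of_norm_bounded hbound fun m => by simpa [abs_mul] using hle m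
  have hodd : Summable fun k => 2 * f (2 * k + 1) :=
    (hsum.comp_injective fun a b h => by simpa using h : Summable fun k => f (2 * k + 1)).mul_left 2
  have hdiff : K x ρ - ∑' m, (-1) ^ m * f m = ∑' k, 2 * f (2 * k + 1) := by
    rw [hK, ← hsum.tsum_sub hsum']
    have heven : HasSum (fun k => f (2 * k) - (-1) ^ (2 * k) * f (2 * k)) 0 := by
      simp [pow_mul, hasSum_zero]
    have hodd' : HasSum (fun k => f (2 * k + 1) - (-1) ^ (2 * k + 1) * f (2 * k + 1))
        (∑' k, 2 * f (2 * k + 1)) := by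
      convert hodd.hasSum using 2 with k
      rw [pow_succ, pow_mul]
      ring
    rw [(HasSum.even_add_odd (f := fun m => f m - (-1) ^ m * f m) heven hodd').tsum_eq, zero_add]
  set w : ℕ → ℝ := fun k => φ (2 * k + 2) / 4 with hw
  set a : ℕ → ℝ := fun k => sin (((k : ℝ) + 1) * (2 * x)) * sin (((k : ℝ) + 1) * (2 * ρ)) /
    ((k : ℝ) + 1) ^ 3 with ha
  have hterm (k : ℕ) : 2 * f (2 * k + 1) = w k * a k := by
    simp only [hf, hw, ha]
    push_cast
    rw [show (2 * (k : ℝ) + 1 + 1) = 2 * (k + 1) by ring, mul_left_comm _ 2 x,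
      mul_left_comm _ 2 ρ, mul_assoc, mul_assoc 2 _ x, mul_assoc 2 _ ρ]
    field_simp
    ring
  have hwanti : StrictAnti w := fun i j hij => by
    have h : φ (2 * j + 2) < φ (2 * i + 2) := hanti (by omega : 2 * i + 1 < 2 * j + 1)
    simp only [hw]
    linarith
  have hlower : (w 0 - w 1) * a 0 ≤ ∑' k, 2 * f (2 * k + 1) := by
    refine ge_of_tendsto' ((Filter.tendsto_add_atTop_iff_nat 1).2 hodd.hasSum.tendsto_sum_nat)
      fun n => ?_
    simp only [hterm]
    refine sub_mul_le_sum_mul_of_antitone w a hwanti.antitone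
      (fun k => (div_pos (hpos (2 * k + 1)) (by norm_num)).le) (fun N => ?_) n
    exact sum_sin_mul_sin_div_cube_nonneg N ⟨by linarith [hx.1], by linarith [hx.2]⟩
      ⟨by linarith [hρ.1], by linarith [hρ.2]⟩
  have hw01 : 0 < w 0 - w 1 := sub_pos.2 (hwanti one_pos)
  have ha0 : a 0 = sin (2 * x) * sin (2 * ρ) := by simp [ha]
  rw [hK1, hK2, max_self]
  constructor
  · have h : 0 ≤ a 0 := by
      rw [ha0]
      exact mul_nonneg
        (sin_nonneg_of_nonneg_of_le_pi (by linarith [hx.1]) (by linarith [hx.2]))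
        (sin_nonneg_of_nonneg_of_le_pi (by linarith [hρ.1]) (by linarith [hρ.2]))
    linarith [mul_nonneg hw01.le h]
  · intro hx' hρ'
    have h : 0 < a 0 := by
      rw [ha0]
      exact mul_pos
        (sin_pos_of_pos_of_lt_pi (by linarith [hx'.1]) (by linarith [hx'.2]))
        (sin_pos_of_pos_of_lt_pi (by linarith [hρ'.1]) (by linarith [hρ'.2]))
    linarith [mul_pos hw01 h]
end
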